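/- For every point-shift F, every n ∈ ℕ and every function h : ℕ → [0, ∞), E_{μ_0}[h(d_n(0))] = h(0)·μ_0(0 ∉ F_ω^n(ω)) + E_{μ_0}[h(l_n(0))/l_n(0)], where d_n(0) := #{y ∈ ω : F_ω^n(y) = 0}, l_n(0) := #{y ∈ ω : F_ω^n(y) = F_ω^n(0)} (which satisfies l_n(0) ≥ 1 and is μ_0-almost surely finite), and F_ω^n(ω) denotes the image of ω under the n-th iterate of F_ω. -/

import Mathlib

open Function Set MeasureTheory ProbabilityTheory
open scoped ENNReal NNReal

namespace PointShift

/-- Points of the grid `ℤ^d`. -/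
abbrev Pt (d : ℕ) := Fin d → ℤ

/-- Configurations: subsets of the grid `ℤ^d`, identified with `{0,1}`-valued
functions, equipped with the product σ-algebra. -/
abbrev Conf (d : ℕ) := Pt d → Bool

/-- The shift `θ_t ω = ω - t`. -/
def shift {d : ℕ} (t : Pt d) (ω : Conf d) : Conf d := fun x => ω (x + t)

/-- The support of a configuration, as a subset of `ℤ^d`. -/
def pts {d : ℕ} (ω : Conf d) : Set (Pt d) := {x | ω x = true}

/-- `g` is a point-map: it is measurable and selects a point of every
configuration having a point at the origin. -/
def IsPointMap {d : ℕ} (g : Conf d → Pt d) : Prop :=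
  Measurable g ∧ ∀ ω : Conf d, ω 0 = true → ω (g ω) = true

/-- The point-shift associated with a point-map `g`: `F_ω x = x + g (θ_x ω)`. -/
def Fps {d : ℕ} (g : Conf d → Pt d) (ω : Conf d) (x : Pt d) : Pt d :=
  x + g (shift x ω)

/-- `μ` is a stationary point process on the grid: a shift-invariant probability
measure with a point at the origin with positive probability. -/
def IsStationaryPP {d : ℕ} (μ : Measure (Conf d)) : Prop :=
  IsProbabilityMeasure μ ∧ (∀ t : Pt d, μ.map (shift t) = μ) ∧
    0 < μ {ω : Conf d | ω 0 = true}

/-- The Palm probability of `μ`: `μ` conditioned on having a point at the origin. -/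
noncomputable def Palm {d : ℕ} (μ : Measure (Conf d)) : Measure (Conf d) :=
  μ[|{ω : Conf d | ω 0 = true}]

/-- The foil of the point `x` in the configuration `ω`, for the point-shift of `g`. -/
def foilOn {d : ℕ} (g : Conf d → Pt d) (ω : Conf d) (x : Pt d) : Set (Pt d) :=
  {y | ω y = true ∧ ∃ n : ℕ, (Fps g ω)^[n] y = (Fps g ω)^[n] x}

/-- The connected component of the point `x` in the functional graph `G^F(ω)`. -/
def compOn {d : ℕ} (g : Conf d → Pt d) (ω : Conf d) (x : Pt d) : Set (Pt d) :=
  {y | ω y = true ∧ ∃ m n : ℕ, (Fps g ω)^[m] x = (Fps g ω)^[n] y}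

/-- `K` is a directed cycle of the functional graph of `f`: a finite set of
distinct points `c 0, …, c (k-1)` (with `k ≥ 1`) such that `f (c i) = c ((i+1) % k)`. -/
def IsCycle {X : Type*} (f : X → X) (K : Set X) : Prop :=
  ∃ (k : ℕ) (c : ℕ → X), 0 < k ∧
    (∀ i < k, ∀ j < k, c i = c j → i = j) ∧
    (∀ i < k, f (c i) = c ((i + 1) % k)) ∧
    K = c '' {i | i < k}

end PointShift

namespace PointShift

variable {d : ℕ}

lemma shift_shift (s t : Pt d) (ω : Conf d) : shift s (shift t ω) = shift (s + t) ω := by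
  funext x
  simp [shift, add_assoc]

lemma measurable_shift (t : Pt d) : Measurable (shift t : Conf d → Conf d) :=
  measurable_pi_lambda _ fun _ => measurable_pi_apply _

lemma measurableSet_apply_eq_true (x : Pt d) : MeasurableSet {ω : Conf d | ω x = true} :=
  measurable_pi_apply (X := fun _ : Pt d => Bool) x (measurableSet_singleton true)

lemma measurable_Fps {g : Conf d → Pt d} (hg : Measurable g) (x : Pt d) :
    Measurable fun ω => Fps g ω x :=
  (hg.comp (measurable_shift x)).const_add x

lemma Fps_shift (g : Conf d → Pt d) (ω : Conf d) (t x : Pt d) :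
    Fps g (shift t ω) x + t = Fps g ω (x + t) := by
  simp only [Fps, shift_shift]
  abel

/-- Iterates of point-shifts are point-shifts. -/
lemma exists_isPointMap_iterate {g : Conf d → Pt d} (hg : IsPointMap g) (n : ℕ) :
    ∃ g' : Conf d → Pt d, IsPointMap g' ∧ ∀ ω, (Fps g ω)^[n] = Fps g' ω := by
  induction n with
  | zero =>
    exact ⟨fun _ => 0, ⟨measurable_const, fun _ h => h⟩, fun ω => by funext x; simp [Fps]⟩
  | succ n ih =>
    obtain ⟨g', hg', hF⟩ := ih
    have hmeas : Measurable fun p : Pt d × Conf d => Fps g' p.2 p.1 :=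
      measurable_from_prod_countable_right fun x => measurable_Fps hg'.1 x
    refine ⟨fun ω => Fps g' ω (g ω), ⟨hmeas.comp (hg.1.prodMk measurable_id), ?_⟩, ?_⟩
    · intro ω h0
      have h := hg'.2 (shift (g ω) ω) (by simpa [shift] using hg.2 ω h0)
      simpa [shift, Fps, add_comm] using h
    · intro ω
      funext x
      rw [iterate_succ_apply, hF, Fps.eq_1 (fun ω => Fps g' ω (g ω)), add_comm x, Fps_shift,
        Fps.eq_1 g, add_comm x]

/-- The preimages, among the points of `ω`, of `x` under the point-shift of `g`. -/
def fiber (g : Conf d → Pt d) (ω : Conf d) (x : Pt d) : Set (Pt d) :=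
  {y | ω y = true ∧ Fps g ω y = x}

lemma fiber_shift (g : Conf d → Pt d) (ω : Conf d) (t x : Pt d) :
    fiber g (shift t ω) x = (Equiv.addRight t) ⁻¹' fiber g ω (x + t) := by
  ext y
  simp [fiber, ← Fps_shift, shift]

lemma ncard_fiber_shift (g : Conf d → Pt d) (ω : Conf d) (t x : Pt d) :
    (fiber g (shift t ω) x).ncard = (fiber g ω (x + t)).ncard := by
  rw [fiber_shift, ← Equiv.image_symm_eq_preimage,
    ncard_image_of_injective _ (Equiv.injective _)]

lemma finite_fiber_shift (g : Conf d → Pt d) (ω : Conf d) (t x : Pt d) :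
    (fiber g (shift t ω) x).Finite ↔ (fiber g ω (x + t)).Finite := by
  rw [fiber_shift, ← Equiv.image_symm_eq_preimage,
    finite_image_iff (Equiv.injective _).injOn]

/-- Seen from a preimage `y` of the origin, the image of `y` is the origin. -/
lemma Fps_shift_zero_add {g : Conf d → Pt d} {ω : Conf d} {y : Pt d} (hy : y ∈ fiber g ω 0) :
    Fps g (shift y ω) 0 + y = 0 := by
  rw [Fps_shift, zero_add, hy.2]

lemma measurableSet_mem_fiber {g : Conf d → Pt d} (hg : Measurable g) {f : Conf d → Pt d}
    (hf : Measurable f) (y : Pt d) : MeasurableSet {ω | y ∈ fiber g ω (f ω)} :=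
  (measurableSet_apply_eq_true y).inter (measurableSet_eq_fun (measurable_Fps hg y) hf)

lemma measurable_toENNReal_encard {Ω ι : Type*} [MeasurableSpace Ω] [Countable ι]
    {S : Ω → Set ι} (hS : ∀ i, MeasurableSet {ω | i ∈ S ω}) :
    Measurable fun ω => ((S ω).encard : ℝ≥0∞) := by
  have h : (fun ω => ((S ω).encard : ℝ≥0∞)) =
      fun ω => ∑' i, {ω | i ∈ S ω}.indicator (fun _ => (1 : ℝ≥0∞)) ω := by
    funext ω
    rw [← ENNReal.tsum_set_one, tsum_subtype (S ω) fun _ => (1 : ℝ≥0∞)]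
    rfl
  rw [h]
  exact Measurable.tsum fun i => measurable_const.indicator (hS i)

lemma measurable_ncard {Ω ι : Type*} [MeasurableSpace Ω] [Countable ι]
    {S : Ω → Set ι} (hS : ∀ i, MeasurableSet {ω | i ∈ S ω}) :
    Measurable fun ω => (S ω).ncard := by
  have h : (fun ω => (S ω).ncard) = fun ω => ⌊((S ω).encard : ℝ≥0∞).toReal⌋₊ := by
    funext ω
    rcases (S ω).finite_or_infinite with hfin | hinf
    · rw [← hfin.cast_ncard_eq]
      simp
    · simp [hinf.ncard, hinf.encard_eq]
  rw [h]
  exact Nat.measurable_floor.comp (measurable_toENNReal_encard hS).ennreal_toReal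

lemma measurableSet_finite {Ω ι : Type*} [MeasurableSpace Ω] [Countable ι]
    {S : Ω → Set ι} (hS : ∀ i, MeasurableSet {ω | i ∈ S ω}) :
    MeasurableSet {ω | (S ω).Finite} := by
  have h : {ω | (S ω).Finite} = (fun ω => ((S ω).encard : ℝ≥0∞)) ⁻¹' {⊤}ᶜ := by
    ext ω
    simp [encard_eq_top_iff]
  rw [h]
  exact measurable_toENNReal_encard hS (measurableSet_singleton _).compl

/-- The mass transport principle along a point-shift: each point `y` of the configuration sends
mass `φ (θ_y ω)` to its image. -/
lemma setLIntegral_eq_lintegral_tsum_fiber {μ : Measure (Conf d)}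
    (hinv : ∀ t : Pt d, μ.map (shift t) = μ) {g : Conf d → Pt d} (hg : Measurable g)
    {φ : Conf d → ℝ≥0∞} (hφ : Measurable φ) :
    ∫⁻ ω in {ω | ω 0 = true}, φ ω ∂μ =
      ∫⁻ ω, ∑' y : fiber g ω 0, φ (shift (y : Pt d) ω) ∂μ := by
  classical
  set ψ : Pt d → Conf d → ℝ≥0∞ :=
    fun y => ({ω | ω 0 = true} ∩ {ω | g ω = -y}).indicator φ with hψ
  have hψm (y : Pt d) : Measurable (ψ y) :=
    hφ.indicator ((measurableSet_apply_eq_true 0).inter (hg (measurableSet_singleton (-y))))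
  have hright (ω : Conf d) :
      ∑' y : fiber g ω 0, φ (shift (y : Pt d) ω) = ∑' y, ψ y (shift y ω) := by
    rw [tsum_subtype (fiber g ω 0) fun y => φ (shift y ω)]
    refine tsum_congr fun y => ?_
    have hiff : y ∈ fiber g ω 0 ↔ shift y ω ∈ {ω : Conf d | ω 0 = true} ∩ {ω | g ω = -y} := by
      simp [fiber, Fps, shift, eq_neg_iff_add_eq_zero, add_comm]
    simp only [hψ, indicator_apply, hiff]
  have hleft (ω : Conf d) : ∑' y, ψ y ω = {ω : Conf d | ω 0 = true}.indicator φ ω := by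
    rw [tsum_eq_single (-g ω) fun y hy => indicator_of_notMem
      (fun h => hy (by rw [show g ω = -y from h.2, neg_neg])) _]
    simp [indicator_apply]
  calc ∫⁻ ω in {ω | ω 0 = true}, φ ω ∂μ = ∫⁻ ω, ∑' y, ψ y ω ∂μ := by
        rw [← lintegral_indicator (measurableSet_apply_eq_true 0)]
        exact lintegral_congr fun ω => (hleft ω).symm
    _ = ∑' y, ∫⁻ ω, ψ y ω ∂μ := lintegral_tsum fun y => (hψm y).aemeasurable
    _ = ∑' y, ∫⁻ ω, ψ y (shift y ω) ∂μ := by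
        refine tsum_congr fun y => ?_
        rw [← lintegral_map (hψm y) (measurable_shift y), hinv y]
    _ = ∫⁻ ω, ∑' y, ψ y (shift y ω) ∂μ :=
        (lintegral_tsum fun y => ((hψm y).comp (measurable_shift y)).aemeasurable).symm
    _ = _ := lintegral_congr fun ω => (hright ω).symm

lemma ae_finite_fiber_zero {μ : Measure (Conf d)} [IsFiniteMeasure μ]
    (hinv : ∀ t : Pt d, μ.map (shift t) = μ) {g : Conf d → Pt d} (hg : Measurable g) :
    ∀ᵐ ω ∂μ, (fiber g ω 0).Finite := by
  have hm : Measurable fun ω => ((fiber g ω 0).encard : ℝ≥0∞) :=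
    measurable_toENNReal_encard fun y => measurableSet_mem_fiber hg measurable_const y
  have h := setLIntegral_eq_lintegral_tsum_fiber hinv hg (measurable_const (a := (1 : ℝ≥0∞)))
  simp only [ENNReal.tsum_set_one, setLIntegral_one] at h
  filter_upwards [ae_lt_top hm (h ▸ measure_ne_top μ _)] with ω hω
  rw [← encard_ne_top_iff]
  intro htop
  simp [htop] at hω

lemma ae_finite_fiber_Fps_zero {μ : Measure (Conf d)} [IsFiniteMeasure μ]
    (hinv : ∀ t : Pt d, μ.map (shift t) = μ) {g : Conf d → Pt d} (hg : Measurable g) :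
    ∀ᵐ ω ∂μ, (fiber g ω (Fps g ω 0)).Finite := by
  have h (x : Pt d) : ∀ᵐ ω ∂μ, (fiber g ω x).Finite := by
    have h0 := ae_finite_fiber_zero hinv hg
    rw [← hinv x] at h0
    filter_upwards [ae_of_ae_map (measurable_shift x).aemeasurable h0] with ω hω
    simpa [finite_fiber_shift] using hω
  filter_upwards [ae_all_iff.2 h] with ω hω using hω _

lemma setLIntegral_ncard_fiber {μ : Measure (Conf d)} [IsFiniteMeasure μ]
    (hinv : ∀ t : Pt d, μ.map (shift t) = μ) {g : Conf d → Pt d} (hg : IsPointMap g)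
    (h : ℕ → ℝ≥0) :
    ∫⁻ ω in {ω | ω 0 = true}, (h (fiber g ω 0).ncard : ℝ≥0∞) ∂μ =
      (h 0 : ℝ≥0∞) * μ.restrict {ω | ω 0 = true} {ω | 0 ∉ Fps g ω '' pts ω} +
        ∫⁻ ω in {ω | ω 0 = true}, (h (fiber g ω (Fps g ω 0)).ncard : ℝ≥0∞) /
          ((fiber g ω (Fps g ω 0)).ncard : ℝ≥0∞) ∂μ := by
  have hquot : Measurable fun k : ℕ => (h k : ℝ≥0∞) / (k : ℝ≥0∞) := measurable_from_nat
  have hmem (ω : Conf d) : 0 ∉ Fps g ω '' pts ω ↔ fiber g ω 0 = ∅ := by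
    simp [fiber, pts, eq_empty_iff_forall_notMem]
  have hE : MeasurableSet {ω | 0 ∉ Fps g ω '' pts ω} := by
    have heq : {ω | 0 ∉ Fps g ω '' pts ω} = ⋂ y, {ω | y ∈ fiber g ω 0}ᶜ := by
      ext ω
      simp only [mem_ofPred_eq, hmem, eq_empty_iff_forall_notMem, mem_iInter, mem_compl_iff]
    rw [heq]
    exact .iInter fun y => (measurableSet_mem_fiber hg.1 measurable_const y).compl
  have hmass := setLIntegral_eq_lintegral_tsum_fiber hinv hg.1 (hquot.comp
    (measurable_ncard fun y => measurableSet_mem_fiber hg.1 (measurable_Fps hg.1 0) y))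
  simp only [comp_apply] at hmass
  have hzero (ω : Conf d) (hω : ω ∉ {ω : Conf d | ω 0 = true}) : fiber g ω 0 = ∅ := by
    refine eq_empty_of_forall_notMem fun y hy => hω ?_
    have := hg.2 (shift y ω) (by simpa [shift] using hy.1)
    rwa [shift, add_comm, show y + g (shift y ω) = 0 from hy.2] at this
  have hsupp : ∫⁻ ω, ∑' y : fiber g ω 0, (h (fiber g (shift y ω) (Fps g (shift y ω) 0)).ncard :
        ℝ≥0∞) / ((fiber g (shift y ω) (Fps g (shift y ω) 0)).ncard : ℝ≥0∞) ∂μ =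
      ∫⁻ ω in {ω | ω 0 = true}, ∑' y : fiber g ω 0,
        (h (fiber g (shift y ω) (Fps g (shift y ω) 0)).ncard : ℝ≥0∞) /
          ((fiber g (shift y ω) (Fps g (shift y ω) 0)).ncard : ℝ≥0∞) ∂μ := by
    rw [← lintegral_indicator (measurableSet_apply_eq_true 0)]
    refine lintegral_congr fun ω => ?_
    by_cases hω : ω ∈ {ω : Conf d | ω 0 = true}
    · rw [indicator_of_mem hω]
    · have := isEmpty_coe_sort.2 (hzero ω hω)
      rw [indicator_of_notMem hω, tsum_empty]
  rw [hmass, hsupp, ← lintegral_indicator_const hE, ← lintegral_add_left (measurable_const.indicator hE)]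
  refine lintegral_congr_ae ?_
  filter_upwards [ae_restrict_of_ae (ae_finite_fiber_zero hinv hg.1)] with ω hfin
  have hsum : ∑' y : fiber g ω 0, (h (fiber g (shift y ω) (Fps g (shift y ω) 0)).ncard : ℝ≥0∞) /
        ((fiber g (shift y ω) (Fps g (shift y ω) 0)).ncard : ℝ≥0∞) =
      (fiber g ω 0).ncard * ((h (fiber g ω 0).ncard : ℝ≥0∞) / (fiber g ω 0).ncard) := by
    have hcongr (y : fiber g ω 0) : (fiber g (shift y ω) (Fps g (shift y ω) 0)).ncard =
        (fiber g ω 0).ncard := by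
      rw [ncard_fiber_shift, Fps_shift_zero_add y.2]
    simp only [hcongr]
    rw [ENNReal.tsum_set_const, ← hfin.cast_ncard_eq]
    simp
  rw [hsum]
  by_cases hempty : fiber g ω 0 = ∅
  · rw [indicator_of_mem (show ω ∈ {ω | 0 ∉ Fps g ω '' pts ω} from (hmem ω).2 hempty)]
    simp [hempty]
  · rw [indicator_of_notMem (fun hω => hempty ((hmem ω).1 hω)), zero_add, ENNReal.mul_div_cancel]
    · simpa [ncard_eq_zero hfin] using hempty
    · exact ENNReal.natCast_ne_top _

end PointShift


/-- For every point-shift `F`, `n ∈ ℕ` and `h : ℕ → [0,∞)`,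
`E_{μ₀}[h(d_n(0))] = h(0) μ₀(0 ∉ F^n(ω)) + E_{μ₀}[h(l_n(0))/l_n(0)]`, where `l_n(0)`
is `≥ 1` and finite `μ₀`-almost surely. -/
theorem stmt_15 {d : ℕ} (hd : 0 < d)
    (μ : Measure (PointShift.Conf d)) [IsProbabilityMeasure μ]
    (hinv : ∀ t : PointShift.Pt d, μ.map (PointShift.shift t) = μ)
    (hpos : 0 < μ {ω : PointShift.Conf d | ω 0 = true})
    (g : PointShift.Conf d → PointShift.Pt d) (hg : PointShift.IsPointMap g)
    (n : ℕ) (h : ℕ → ℝ≥0) :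
    (∀ᵐ ω ∂(PointShift.Palm μ),
      {y : PointShift.Pt d | ω y = true ∧
        (PointShift.Fps g ω)^[n] y = (PointShift.Fps g ω)^[n] 0}.Finite ∧
      1 ≤ {y : PointShift.Pt d | ω y = true ∧
        (PointShift.Fps g ω)^[n] y = (PointShift.Fps g ω)^[n] 0}.ncard) ∧
    ∫⁻ ω, (h ({y : PointShift.Pt d | ω y = true ∧
          (PointShift.Fps g ω)^[n] y = 0}.ncard) : ℝ≥0∞) ∂(PointShift.Palm μ)
      = (h 0 : ℝ≥0∞) *
          PointShift.Palm μ {ω : PointShift.Conf d |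
            0 ∉ (PointShift.Fps g ω)^[n] '' PointShift.pts ω}
        + ∫⁻ ω, (h ({y : PointShift.Pt d | ω y = true ∧
              (PointShift.Fps g ω)^[n] y = (PointShift.Fps g ω)^[n] 0}.ncard) : ℝ≥0∞) /
            (({y : PointShift.Pt d | ω y = true ∧
              (PointShift.Fps g ω)^[n] y = (PointShift.Fps g ω)^[n] 0}.ncard : ℕ) : ℝ≥0∞)
            ∂(PointShift.Palm μ) := by
  obtain ⟨g', hg', hF⟩ := PointShift.exists_isPointMap_iterate hg n
  simp only [hF]
  have hA := PointShift.measurableSet_apply_eq_true (0 : PointShift.Pt d)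
  constructor
  · filter_upwards [cond_absolutelyContinuous.ae_le
      (PointShift.ae_finite_fiber_Fps_zero hinv hg'.1), ae_cond_mem hA] with ω hfin h0
    exact ⟨hfin, (Set.ncard_pos hfin).2 ⟨0, h0, rfl⟩⟩
  · have hmain := PointShift.setLIntegral_ncard_fiber hinv hg' h
    simp only [PointShift.fiber] at hmain
    simp only [PointShift.Palm, ProbabilityTheory.cond, lintegral_smul_measure,
      Measure.smul_apply, smul_eq_mul, hmain]
    ring
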